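/- Let K ∈ ℝ^{k×k×g×h} be a multi-channel convolutional kernel and let M = M(K) be the hN²×gN² structured transformation matrix corresponding to K. Assume the smallest singular value σ_min(M) is positive and simple (the eigenvalue σ_min(M)² of MᵀM has multiplicity one), and let u, v be normalized left and right singular vectors of M associated with σ_min(M) (Mv = σ_min(M)·u, Mᵀu = σ_min(M)·v, ‖u‖₂ = ‖v‖₂ = 1). Fix kernel indices (p,q,z,y) and let Ω_{p,q,z,y} be the set of all matrix index pairs ((c,r,s),(d,i,j)) at which the entry of M(K) equals K_{p,q,z,y}. Then the function t ↦ σ_min(M(K + t·E_{pqzy})) has derivative at t = 0 equal to Σ_{((c,r,s),(d,i,j)) ∈ Ω_{p,q,z,y}} u(c,r,s)·v(d,i,j), where u(c,r,s) denotes the entry of u at index (c,r,s) and v(d,i,j) the entry of v at index (d,i,j). -/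

import Mathlib

open Matrix
open scoped BigOperators

noncomputable section

/-- Square of the Frobenius norm of a real matrix: `‖A‖_F² = ∑ i j, (A i j)²`. -/
def frobSq {m n : Type*} [Fintype m] [Fintype n] (A : Matrix m n ℝ) : ℝ :=
  ∑ i, ∑ j, A i j ^ 2

/-- The Euclidean (ℓ²) norm of a real vector. -/
def l2norm {n : Type*} [Fintype n] (x : n → ℝ) : ℝ :=
  Real.sqrt (∑ i, x i ^ 2)

/-- A singular value `σ` of `A` is simple if the eigenvalue `σ²` of `AᵀA` has
multiplicity one, i.e. the corresponding eigenspace is one-dimensional. -/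
def IsSimpleSingularValue {m n : Type*} [Fintype m] [Fintype n] [DecidableEq n]
    (A : Matrix m n ℝ) (σ : ℝ) : Prop :=
  Module.finrank ℝ (Module.End.eigenspace (Matrix.mulVecLin (Aᵀ * A)) (σ ^ 2)) = 1

/-- The smallest singular value of `A` : `σ_min(A) = min_{‖x‖₂ = 1} ‖A x‖₂`. -/
def sigmaMin {m n : Type*} [Fintype m] [Fintype n] (A : Matrix m n ℝ) : ℝ :=
  sInf {c : ℝ | ∃ x : n → ℝ, l2norm x = 1 ∧ c = l2norm (A.mulVec x)}

/-- The entry `K_{p,q,d,c}` of a `k × k × g × h` kernel at 0-based integer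
spatial positions `(p, q)`, extended by zero outside `{0, …, k-1}²`. -/
def kerEntry4 (k g h : ℕ) (K : Fin k → Fin k → Fin g → Fin h → ℝ)
    (p q : ℤ) (d : Fin g) (c : Fin h) : ℝ :=
  if hp : 0 ≤ p ∧ p < k then
    if hq : 0 ≤ q ∧ q < k then K ⟨p.toNat, by omega⟩ ⟨q.toNat, by omega⟩ d c else 0
  else 0

/-- The `hN² × gN²` structured transformation matrix `M(K)` corresponding to a
multi-channel kernel `K ∈ ℝ^{k×k×g×h}`: rows are indexed by triples `(c,r,s)`,
columns by triples `(d,i,j)`; in 1-based notation the entry at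
`((c,r,s),(d,i,j))` equals `K (i-r+m) (j-s+m) d c` if `1 ≤ i-r+m ≤ k` and
`1 ≤ j-s+m ≤ k` (where `m = ⌈k/2⌉`), and `0` otherwise.  Its `(c,d)` block is
the doubly block banded Toeplitz matrix of the one-channel kernel `K_{:,:,d,c}`.
Indices here are 0-based `Fin`s. -/
def convMatrix4 (k g h N : ℕ) (K : Fin k → Fin k → Fin g → Fin h → ℝ) :
    Matrix (Fin h × Fin N × Fin N) (Fin g × Fin N × Fin N) ℝ :=
  fun crs dij =>
    kerEntry4 k g h K
      (((dij.2.1 : ℕ) : ℤ) - ((crs.2.1 : ℕ) : ℤ) + ((k : ℤ) + 1) / 2 - 1)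
      (((dij.2.2 : ℕ) : ℤ) - ((crs.2.2 : ℕ) : ℤ) + ((k : ℤ) + 1) / 2 - 1)
      dij.1 crs.1

/-- The `k × k × g × h` tensor `E_{pqzy}` with `1` in position `(p,q,z,y)` and
`0` elsewhere. -/
def stdKer4 (k g h : ℕ) (p q : Fin k) (z : Fin g) (y : Fin h) :
    Fin k → Fin k → Fin g → Fin h → ℝ :=
  fun p' q' z' y' => if p' = p ∧ q' = q ∧ z' = z ∧ y' = y then 1 else 0

section SingularValuePerturbation

variable {m n : Type*} [Fintype m] [Fintype n]

theorem dotProduct_self_nonneg_real (x : n → ℝ) : 0 ≤ x ⬝ᵥ x :=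
  Finset.sum_nonneg fun _ _ => mul_self_nonneg _

theorem l2norm_eq_sqrt_dotProduct (x : n → ℝ) : l2norm x = √(x ⬝ᵥ x) := by
  simp [l2norm, dotProduct, sq]

theorem l2norm_nonneg (x : n → ℝ) : 0 ≤ l2norm x := Real.sqrt_nonneg _

theorem l2norm_sq (x : n → ℝ) : l2norm x ^ 2 = x ⬝ᵥ x := by
  rw [l2norm_eq_sqrt_dotProduct, Real.sq_sqrt (dotProduct_self_nonneg_real x)]

theorem l2norm_eq_one_iff (x : n → ℝ) : l2norm x = 1 ↔ x ⬝ᵥ x = 1 := by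
  rw [l2norm_eq_sqrt_dotProduct, Real.sqrt_eq_one]

theorem abs_dotProduct_le (x y : n → ℝ) : |x ⬝ᵥ y| ≤ l2norm x * l2norm y := by
  apply abs_le_of_sq_le_sq _ (mul_nonneg (l2norm_nonneg x) (l2norm_nonneg y))
  rw [mul_pow, l2norm, l2norm, Real.sq_sqrt (by positivity), Real.sq_sqrt (by positivity)]
  exact Finset.sum_mul_sq_le_sq_mul_sq _ _ _

theorem l2norm_mulVec_le (A : Matrix m n ℝ) (x : n → ℝ) :
    l2norm (A *ᵥ x) ≤ √(frobSq A) * l2norm x := by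
  rw [l2norm, l2norm, frobSq, ← Real.sqrt_mul (by positivity), Finset.sum_mul]
  exact Real.sqrt_le_sqrt (Finset.sum_le_sum fun i _ => Finset.sum_mul_sq_le_sq_mul_sq _ _ _)

theorem abs_dotProduct_mulVec_le (A : Matrix m n ℝ) (x : m → ℝ) (y : n → ℝ) :
    |x ⬝ᵥ A *ᵥ y| ≤ √(frobSq A) * (l2norm x * l2norm y) := by
  have h1 := abs_dotProduct_le x (A *ᵥ y)
  have h2 := mul_le_mul_of_nonneg_left (l2norm_mulVec_le A y) (l2norm_nonneg x)
  linarith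

theorem sigmaMin_nonneg (A : Matrix m n ℝ) : 0 ≤ sigmaMin A :=
  Real.sInf_nonneg (by rintro _ ⟨x, -, rfl⟩; exact l2norm_nonneg _)

theorem sigmaMin_sq_le (A : Matrix m n ℝ) {x : n → ℝ} (hx : l2norm x = 1) :
    sigmaMin A ^ 2 ≤ (A *ᵥ x) ⬝ᵥ (A *ᵥ x) := by
  rw [← l2norm_sq]
  refine pow_le_pow_left₀ (sigmaMin_nonneg A) (csInf_le ⟨0, ?_⟩ ⟨x, hx, rfl⟩) 2
  rintro _ ⟨x, -, rfl⟩
  exact l2norm_nonneg _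

theorem le_sigmaMin_sq (A : Matrix m n ℝ) {v : n → ℝ} (hv : l2norm v = 1) {L : ℝ}
    (hL : ∀ x : n → ℝ, l2norm x = 1 → L ≤ (A *ᵥ x) ⬝ᵥ (A *ᵥ x)) : L ≤ sigmaMin A ^ 2 := by
  rw [← Real.sqrt_le_left (sigmaMin_nonneg A)]
  refine le_csInf ⟨_, v, hv, rfl⟩ ?_
  rintro _ ⟨x, hx, rfl⟩
  rw [l2norm_eq_sqrt_dotProduct]
  exact Real.sqrt_le_sqrt (hL x hx)

theorem mul_dotProduct_self_le_of_normalized (A : Matrix m n ℝ) {x : n → ℝ} {L : ℝ}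
    (hL : l2norm ((l2norm x)⁻¹ • x) = 1 →
      L ≤ (A *ᵥ ((l2norm x)⁻¹ • x)) ⬝ᵥ (A *ᵥ ((l2norm x)⁻¹ • x))) :
    L * (x ⬝ᵥ x) ≤ (A *ᵥ x) ⬝ᵥ (A *ᵥ x) := by
  rcases (dotProduct_self_nonneg_real x).eq_or_lt with h | h
  · rw [← h, mul_zero]
    exact dotProduct_self_nonneg_real _
  · have hne : l2norm x ≠ 0 := by
      intro h0
      rw [← l2norm_sq, h0] at h
      norm_num at h
    have hunit : l2norm ((l2norm x)⁻¹ • x) = 1 := by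
      rw [l2norm_eq_one_iff, smul_dotProduct, dotProduct_smul, smul_eq_mul, smul_eq_mul,
        ← l2norm_sq]
      field_simp
    have := hL hunit
    rwa [mulVec_smul, smul_dotProduct, dotProduct_smul, smul_eq_mul, smul_eq_mul, ← mul_assoc,
      ← mul_inv, ← sq, l2norm_sq, inv_mul_eq_div, le_div_iff₀ h] at this

theorem sigmaMin_sq_mul_le (A : Matrix m n ℝ) (x : n → ℝ) :
    sigmaMin A ^ 2 * (x ⬝ᵥ x) ≤ (A *ᵥ x) ⬝ᵥ (A *ᵥ x) :=
  mul_dotProduct_self_le_of_normalized A (sigmaMin_sq_le A)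

theorem mulVec_dotProduct_mulVec (A B : Matrix m n ℝ) (x y : n → ℝ) :
    (A *ᵥ x) ⬝ᵥ (B *ᵥ y) = x ⬝ᵥ (Aᵀ * B) *ᵥ y := by
  rw [← mulVec_mulVec, dotProduct_mulVec x, vecMul_transpose]

variable [DecidableEq n]

theorem mem_eigenspace_of_sigmaMin_attained (A : Matrix m n ℝ) {x : n → ℝ}
    (hx : (A *ᵥ x) ⬝ᵥ (A *ᵥ x) = sigmaMin A ^ 2 * (x ⬝ᵥ x)) :
    x ∈ Module.End.eigenspace (mulVecLin (Aᵀ * A)) (sigmaMin A ^ 2) := by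
  have hform (y : n → ℝ) : y ⬝ᵥ (Aᵀ * A - sigmaMin A ^ 2 • 1) *ᵥ y
      = (A *ᵥ y) ⬝ᵥ (A *ᵥ y) - sigmaMin A ^ 2 * (y ⬝ᵥ y) := by
    rw [sub_mulVec, dotProduct_sub, smul_mulVec, one_mulVec, dotProduct_smul, smul_eq_mul,
      mulVec_dotProduct_mulVec]
  have hpsd : (Aᵀ * A - sigmaMin A ^ 2 • (1 : Matrix n n ℝ)).PosSemidef := by
    refine PosSemidef.of_dotProduct_mulVec_nonneg ?_ fun y => ?_
    · simp [IsHermitian, conjTranspose_eq_transpose_of_trivial]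
    · rw [star_trivial, hform]
      linarith [sigmaMin_sq_mul_le A y]
  have h0 := (hpsd.dotProduct_mulVec_zero_iff x).1 (by rw [star_trivial, hform, hx, sub_self])
  rw [sub_mulVec, smul_mulVec, one_mulVec, sub_eq_zero] at h0
  rw [Module.End.mem_eigenspace_iff]
  exact h0

theorem exists_gap_of_isSimpleSingularValue (A : Matrix m n ℝ) {v : n → ℝ} (hv : l2norm v = 1)
    (hsimple : IsSimpleSingularValue A (sigmaMin A))
    (hAv : (Aᵀ * A) *ᵥ v = sigmaMin A ^ 2 • v) :
    ∃ δ > 0, ∀ w : n → ℝ, w ⬝ᵥ v = 0 →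
      (sigmaMin A ^ 2 + δ) * (w ⬝ᵥ w) ≤ (A *ᵥ w) ⬝ᵥ (A *ᵥ w) := by
  set S : Set (n → ℝ) := {w | w ⬝ᵥ w = 1 ∧ w ⬝ᵥ v = 0}
  have hcompact : IsCompact S := by
    refine Metric.isCompact_of_isClosed_isBounded ?_ ?_
    · exact (isClosed_eq (by fun_prop) continuous_const).inter
        (isClosed_eq (by fun_prop) continuous_const)
    · refine (Metric.isBounded_closedBall (x := 0) (r := 1)).subset fun w hw => ?_
      rw [mem_closedBall_zero_iff, pi_norm_le_iff_of_nonneg zero_le_one]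
      intro i
      rw [Real.norm_eq_abs, ← sq_le_one_iff_abs_le_one, sq, ← hw.1]
      exact Finset.single_le_sum (f := fun i => w i * w i) (fun i _ => mul_self_nonneg _)
        (Finset.mem_univ i)
  have hscale {δ : ℝ} (hδ : ∀ w ∈ S, sigmaMin A ^ 2 + δ ≤ (A *ᵥ w) ⬝ᵥ (A *ᵥ w))
      (w : n → ℝ) (hw : w ⬝ᵥ v = 0) :
      (sigmaMin A ^ 2 + δ) * (w ⬝ᵥ w) ≤ (A *ᵥ w) ⬝ᵥ (A *ᵥ w) :=
    mul_dotProduct_self_le_of_normalized A fun hunit =>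
      hδ _ ⟨(l2norm_eq_one_iff _).1 hunit, by rw [smul_dotProduct, hw, smul_zero]⟩
  rcases S.eq_empty_or_nonempty with hE | hne
  · exact ⟨1, one_pos, hscale (by simp [hE])⟩
  · obtain ⟨w₀, ⟨hw₀, hw₀v⟩, hmin⟩ := hcompact.exists_isMinOn
      (f := fun w => (A *ᵥ w) ⬝ᵥ (A *ᵥ w)) hne (by fun_prop)
    refine ⟨(A *ᵥ w₀) ⬝ᵥ (A *ᵥ w₀) - sigmaMin A ^ 2, ?_,
      hscale fun w hw => by simpa using hmin hw⟩
    rw [gt_iff_lt, sub_pos]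
    refine lt_of_le_of_ne (sigmaMin_sq_le A ((l2norm_eq_one_iff w₀).2 hw₀)) fun heq => ?_
    have hmem := mem_eigenspace_of_sigmaMin_attained A (x := w₀) (by rw [hw₀, mul_one, heq])
    have hv1 := (l2norm_eq_one_iff v).1 hv
    obtain ⟨c, hc⟩ := (finrank_eq_one_iff_of_nonzero'
      (⟨v, Module.End.mem_eigenspace_iff.2 hAv⟩ :
        Module.End.eigenspace (mulVecLin (Aᵀ * A)) (sigmaMin A ^ 2))
      (by
        intro h
        rw [Submodule.mk_eq_zero] at h
        simp [h] at hv1)).1 hsimple ⟨w₀, hmem⟩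
    have hc' : c • v = w₀ := congrArg Subtype.val hc
    rw [← hc', smul_dotProduct, hv1, smul_eq_mul, mul_one] at hw₀v
    rw [← hc', hw₀v] at hw₀
    simp at hw₀

/-- The smallest singular value, if positive and simple, has directional derivative
`uᵀ E v` in the direction `E`. -/
theorem hasDerivAt_sigmaMin_add_smul (A E : Matrix m n ℝ) {u : m → ℝ} {v : n → ℝ}
    (hpos : 0 < sigmaMin A) (hsimple : IsSimpleSingularValue A (sigmaMin A))
    (hv : l2norm v = 1) (hAv : A *ᵥ v = sigmaMin A • u) (hAu : Aᵀ *ᵥ u = sigmaMin A • v) :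
    HasDerivAt (fun t : ℝ => sigmaMin (A + t • E)) (u ⬝ᵥ E *ᵥ v) 0 := by
  have hB : (Aᵀ * A) *ᵥ v = sigmaMin A ^ 2 • v := by
    rw [← mulVec_mulVec, hAv, mulVec_smul, hAu, smul_smul, sq]
  obtain ⟨δ, hδ, hgap⟩ := exists_gap_of_isSimpleSingularValue A hv hsimple hB
  have hv1 := (l2norm_eq_one_iff v).1 hv
  set σ := sigmaMin A with hσ
  set C := √(frobSq (Aᵀ * E))
  have hC0 : 0 ≤ C := Real.sqrt_nonneg _
  have hexpand (t : ℝ) (x : n → ℝ) : ((A + t • E) *ᵥ x) ⬝ᵥ ((A + t • E) *ᵥ x)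
      = (A *ᵥ x) ⬝ᵥ (A *ᵥ x) + 2 * t * (x ⬝ᵥ (Aᵀ * E) *ᵥ x)
        + t ^ 2 * ((E *ᵥ x) ⬝ᵥ (E *ᵥ x)) := by
    rw [← mulVec_dotProduct_mulVec A E, add_mulVec, smul_mulVec]
    simp only [add_dotProduct, dotProduct_add, smul_dotProduct, dotProduct_smul, smul_eq_mul]
    rw [dotProduct_comm (E *ᵥ x) (A *ᵥ x)]
    ring
  have hD : v ⬝ᵥ (Aᵀ * E) *ᵥ v = σ * (u ⬝ᵥ E *ᵥ v) := by
    rw [← mulVec_dotProduct_mulVec, hAv, smul_dotProduct, smul_eq_mul]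
  have hAvv : (A *ᵥ v) ⬝ᵥ (A *ᵥ v) = σ ^ 2 := by
    rw [mulVec_dotProduct_mulVec, hB, dotProduct_smul, hv1, smul_eq_mul, mul_one]
  set D := u ⬝ᵥ E *ᵥ v
  have hupper (t : ℝ) : sigmaMin (A + t • E) ^ 2
      ≤ σ ^ 2 + 2 * t * (σ * D) + t ^ 2 * ((E *ᵥ v) ⬝ᵥ (E *ᵥ v)) := by
    have := sigmaMin_sq_le (A + t • E) hv
    rwa [hexpand, hD, hAvv] at this
  have hlower (t : ℝ) : σ ^ 2 + 2 * t * (σ * D) - t ^ 2 * (16 * C ^ 2 / δ)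
      ≤ sigmaMin (A + t • E) ^ 2 := by
    refine le_sigmaMin_sq _ hv fun x hx => ?_
    rw [hexpand]
    have hEx := mul_nonneg (sq_nonneg t) (dotProduct_self_nonneg_real (E *ᵥ x))
    obtain ⟨a, w, rfl, hwv⟩ : ∃ (a : ℝ) (w : n → ℝ), x = a • v + w ∧ w ⬝ᵥ v = 0 :=
      ⟨x ⬝ᵥ v, x - (x ⬝ᵥ v) • v, by simp, by simp [sub_dotProduct, hv1]⟩
    have hvw : v ⬝ᵥ w = 0 := by rw [dotProduct_comm, hwv]
    have hnorm : a ^ 2 + l2norm w ^ 2 = 1 := by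
      rw [l2norm_eq_one_iff] at hx
      rw [l2norm_sq, ← hx]
      simp only [add_dotProduct, dotProduct_add, smul_dotProduct, dotProduct_smul, smul_eq_mul,
        hwv, hvw, hv1]
      ring
    have hA : (A *ᵥ (a • v + w)) ⬝ᵥ (A *ᵥ (a • v + w))
        = a ^ 2 * σ ^ 2 + (A *ᵥ w) ⬝ᵥ (A *ᵥ w) := by
      have h1 : (A *ᵥ w) ⬝ᵥ (A *ᵥ v) = 0 := by
        rw [mulVec_dotProduct_mulVec, hB, dotProduct_smul, hwv, smul_zero]
      have h2 : (A *ᵥ v) ⬝ᵥ (A *ᵥ w) = 0 := by rw [dotProduct_comm, h1]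
      simp only [mulVec_add, mulVec_smul, add_dotProduct, dotProduct_add, smul_dotProduct,
        dotProduct_smul, smul_eq_mul, h1, h2, hAvv]
      ring
    have hG : (a • v + w) ⬝ᵥ (Aᵀ * E) *ᵥ (a • v + w) = a ^ 2 * (σ * D)
        + a * (v ⬝ᵥ (Aᵀ * E) *ᵥ w) + a * (w ⬝ᵥ (Aᵀ * E) *ᵥ v) + w ⬝ᵥ (Aᵀ * E) *ᵥ w := by
      simp only [mulVec_add, mulVec_smul, add_dotProduct, dotProduct_add, smul_dotProduct,
        dotProduct_smul, smul_eq_mul, hD]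
      ring
    have hgapw := hgap w hwv
    have hvw' := abs_dotProduct_mulVec_le (Aᵀ * E) v w
    have hwv' := abs_dotProduct_mulVec_le (Aᵀ * E) w v
    have hww' := abs_dotProduct_mulVec_le (Aᵀ * E) w w
    have hvv' := abs_dotProduct_mulVec_le (Aᵀ * E) v v
    rw [← l2norm_sq] at hgapw
    rw [hv, one_mul] at hvw'
    rw [hv, mul_one] at hwv'
    rw [hD, hv, mul_one, mul_one] at hvv'
    rw [hA, hG]
    have hs0 := l2norm_nonneg w
    set s := l2norm w
    set e₁ := v ⬝ᵥ (Aᵀ * E) *ᵥ w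
    set e₂ := w ⬝ᵥ (Aᵀ * E) *ᵥ v
    set e₃ := w ⬝ᵥ (Aᵀ * E) *ᵥ w
    have ha : |a| ≤ 1 := by
      rw [← sq_le_one_iff_abs_le_one]
      linarith [sq_nonneg s]
    have hs1 : s ≤ 1 := by nlinarith [sq_nonneg a]
    have hss : C * (s * s) ≤ C * s :=
      mul_le_mul_of_nonneg_left (mul_le_of_le_one_left hs0 hs1) hC0
    have herr : |a * e₁ + a * e₂ + e₃ - s ^ 2 * (σ * D)| ≤ 4 * C * s := by
      have h1 : |a * e₁| ≤ C * s := by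
        rw [abs_mul]
        exact (mul_le_of_le_one_left (abs_nonneg _) ha).trans hvw'
      have h2 : |a * e₂| ≤ C * s := by
        rw [abs_mul]
        exact (mul_le_of_le_one_left (abs_nonneg _) ha).trans hwv'
      have h3 : |s ^ 2 * (σ * D)| ≤ C * (s * s) := by
        rw [abs_mul, abs_of_nonneg (sq_nonneg s)]
        nlinarith [mul_le_mul_of_nonneg_left hvv' (sq_nonneg s)]
      have h4 := abs_sub (a * e₁ + a * e₂ + e₃) (s ^ 2 * (σ * D))
      have h5 := abs_add_three (a * e₁) (a * e₂) e₃
      linarith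
    have hterr : -(|t| * (4 * C * s)) ≤ t * (a * e₁ + a * e₂ + e₃ - s ^ 2 * (σ * D)) := by
      refine neg_le_of_abs_le ?_
      rw [abs_mul]
      exact mul_le_mul_of_nonneg_left herr (abs_nonneg t)
    have hsquare : 0 ≤ δ * s ^ 2 - 8 * (|t| * (C * s)) + t ^ 2 * (16 * C ^ 2 / δ) := by
      have : δ * s ^ 2 - 8 * (|t| * (C * s)) + t ^ 2 * (16 * C ^ 2 / δ)
          = (δ * s - 4 * |t| * C) ^ 2 / δ := by
        rw [← sq_abs t]
        field_simp
        ring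
      rw [this]
      positivity
    have ha2 : a ^ 2 = 1 - s ^ 2 := by linarith
    rw [ha2]
    linarith
  have hderiv_sq : HasDerivAt (fun t : ℝ => sigmaMin (A + t • E) ^ 2) (2 * (σ * D)) 0 := by
    rw [hasDerivAt_iff_isLittleO]
    refine Asymptotics.IsBigO.trans_isLittleO (g := fun t : ℝ => t ^ 2) ?_ ?_
    · refine Asymptotics.IsBigO.of_bound
        ((E *ᵥ v) ⬝ᵥ (E *ᵥ v) + 16 * C ^ 2 / δ) (Filter.Eventually.of_forall fun t => ?_)
      have h1 := hupper t
      have h2 := hlower t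
      have h3 := mul_nonneg (sq_nonneg t) (dotProduct_self_nonneg_real (E *ᵥ v))
      have h4 : 0 ≤ t ^ 2 * (16 * C ^ 2 / δ) := by positivity
      simp only [zero_smul, add_zero, sub_zero, smul_eq_mul, Real.norm_eq_abs,
        abs_of_nonneg (sq_nonneg t), ← hσ]
      rw [abs_le]
      constructor <;> linarith
    · simpa using Asymptotics.isLittleO_pow_id (𝕜 := ℝ) one_lt_two
  have hsqrt := hderiv_sq.sqrt (by simpa [← hσ] using hpos.ne')
  simp only [Real.sqrt_sq (sigmaMin_nonneg _), zero_smul, add_zero, ← hσ] at hsqrt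
  convert hsqrt using 1
  rw [Real.sqrt_sq hpos.le]
  field_simp

end SingularValuePerturbation

theorem convMatrix4_add_smul (k g h N : ℕ) (K L : Fin k → Fin k → Fin g → Fin h → ℝ) (t : ℝ) :
    convMatrix4 k g h N (K + t • L) = convMatrix4 k g h N K + t • convMatrix4 k g h N L := by
  ext crs dij
  simp only [convMatrix4, kerEntry4, Matrix.add_apply, Matrix.smul_apply]
  split_ifs <;> simp

theorem kerEntry4_stdKer4 (k g h : ℕ) (p q : Fin k) (z : Fin g) (y : Fin h) (a b : ℤ)
    (d : Fin g) (c : Fin h) :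
    kerEntry4 k g h (stdKer4 k g h p q z y) a b d c =
      if a = ((p : ℕ) : ℤ) ∧ b = ((q : ℕ) : ℤ) ∧ d = z ∧ c = y then 1 else 0 := by
  have hp := p.isLt
  have hq := q.isLt
  unfold kerEntry4 stdKer4
  split_ifs with h1 h2 h3 h4 h5 <;> first | rfl | (simp only [Fin.ext_iff] at *; omega)

/-- Multi-channel Regularization 2: if the smallest singular value of
`M = M(K)` is positive and simple, with normalized left/right singular vectors
`u`, `v`, then the function `t ↦ σ_min(M(K + t·E_{pqzy}))` has derivative at
`t = 0` equal to `∑_{((c,r,s),(d,i,j)) ∈ Ω_{p,q,z,y}} u(c,r,s)·v(d,i,j)`. -/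
theorem sigmaMin_convMatrix4_deriv (k g h N : ℕ)
    (K : Fin k → Fin k → Fin g → Fin h → ℝ)
    (u : Fin h × Fin N × Fin N → ℝ) (v : Fin g × Fin N × Fin N → ℝ)
    (hpos : 0 < sigmaMin (convMatrix4 k g h N K))
    (hsimple : IsSimpleSingularValue (convMatrix4 k g h N K)
      (sigmaMin (convMatrix4 k g h N K)))
    (hu : l2norm u = 1) (hv : l2norm v = 1)
    (hMv : (convMatrix4 k g h N K).mulVec v = sigmaMin (convMatrix4 k g h N K) • u)
    (hMu : (convMatrix4 k g h N K)ᵀ.mulVec u = sigmaMin (convMatrix4 k g h N K) • v)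
    (p q : Fin k) (z : Fin g) (y : Fin h) :
    HasDerivAt
      (fun t : ℝ => sigmaMin (convMatrix4 k g h N (K + t • stdKer4 k g h p q z y)))
      (∑ crs : Fin h × Fin N × Fin N, ∑ dij : Fin g × Fin N × Fin N,
        if (((dij.2.1 : ℕ) : ℤ) - ((crs.2.1 : ℕ) : ℤ) + ((k : ℤ) + 1) / 2 - 1 = ((p : ℕ) : ℤ) ∧
            ((dij.2.2 : ℕ) : ℤ) - ((crs.2.2 : ℕ) : ℤ) + ((k : ℤ) + 1) / 2 - 1 = ((q : ℕ) : ℤ) ∧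
            dij.1 = z ∧ crs.1 = y)
        then u crs * v dij else 0) 0 := by
  simp only [convMatrix4_add_smul]
  convert hasDerivAt_sigmaMin_add_smul _ (convMatrix4 k g h N (stdKer4 k g h p q z y))
    hpos hsimple hv hMv hMu using 1
  simp only [dotProduct, mulVec, Finset.mul_sum, convMatrix4, kerEntry4_stdKer4, ite_mul, one_mul,
    zero_mul, mul_ite, mul_zero]
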